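/- Weak regularity lemma for the cut norm ‖·‖_{□,F}: let F be a convergence determining sequence. For every signed measure-valued kernel W and every integer k ≥ 2, there exists a finite measurable partition 𝒫 of [0,1] with exactly k classes such that ‖W − W_𝒫‖_{□,F} ≤ (√8/√(log k)) ‖W‖_{2,F}, where log denotes the natural logarithm. In particular, if W is a probability-graphon (so that ‖W‖_{2,F} ≤ √2), then ‖W − W_𝒫‖_{□,F} ≤ 4/√(log k). -/

import Mathlib

open MeasureTheory Filter Topology
open scoped ENNReal NNReal

noncomputable section

namespace PG

/-- The unit square `[0,1]²`, with its product Lebesgue measure. -/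
abbrev Sq : Type := unitInterval × unitInterval

variable {Z : Type*} [MeasurableSpace Z] [TopologicalSpace Z]

/-! ### Measure-valued kernels and probability-graphons -/

/-- `W(A;·) = ∫_A W(x,y;·) dx dy` for a measure-valued kernel. -/
def kernelInt (W : Sq → Measure Z) (A : Set Sq) : Measure Z :=
  ((volume : Measure Sq).restrict A).bind W

/-- The measure `M_W = W([0,1]²;·)` associated with a (positive) measure-valued kernel. -/
def MW (W : Sq → Measure Z) : Measure Z := (volume : Measure Sq).bind W

/-- A probability-graphon: a measurable map from `[0,1]²` to probability measures on `Z`. -/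
def IsProbGraphon (W : Sq → Measure Z) : Prop :=
  (∀ A : Set Z, MeasurableSet A → Measurable fun p => W p A) ∧
    ∀ p, IsProbabilityMeasure (W p)

/-- Essential supremum of the total mass of a positive measure-valued kernel. -/
def TVboundPos (W : Sq → Measure Z) : ℝ≥0∞ :=
  essSup (fun p => W p Set.univ) (volume : Measure Sq)

/-- A (positive) measure-valued kernel: measurable and essentially bounded. -/
def IsPosKernel (W : Sq → Measure Z) : Prop :=
  (∀ A : Set Z, MeasurableSet A → Measurable fun p => W p A) ∧ TVboundPos W < ⊤

/-- Relabeling `W^φ` of a kernel by a map `φ : [0,1] → [0,1]`. -/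
def relabel (W : Sq → Measure Z) (φ : unitInterval → unitInterval) : Sq → Measure Z :=
  fun p => W (φ p.1, φ p.2)

/-- `φ` is a Lebesgue-measure-preserving map of `[0,1]`. -/
def IsMP (φ : unitInterval → unitInterval) : Prop :=
  MeasurePreserving φ (volume : Measure unitInterval) (volume : Measure unitInterval)

/-- Weak convergence of a sequence of (finite) measures on `Z`. -/
def WeakTendsto (μ : ℕ → Measure Z) (ν : Measure Z) : Prop :=
  ∀ f : BoundedContinuousFunction Z ℝ,
    Tendsto (fun n => ∫ x, f x ∂(μ n)) atTop (𝓝 (∫ x, f x ∂ν))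

/-- The cut distance `d_{□,m}` associated with a distance `d_m` on measures. -/
def cutDist (dm : Measure Z → Measure Z → ℝ) (U W : Sq → Measure Z) : ℝ :=
  ⨆ ST : {p : Set unitInterval × Set unitInterval // MeasurableSet p.1 ∧ MeasurableSet p.2},
    dm (kernelInt U (ST.val.1 ×ˢ ST.val.2)) (kernelInt W (ST.val.1 ×ˢ ST.val.2))

/-- The unlabeled cut distance `δ_□` associated with a distance `d` on kernels:
`δ_□(U,W) = inf_{φ ∈ S_{[0,1]}} d(U, W^φ)`. -/
def deltaCut (d : (Sq → Measure Z) → (Sq → Measure Z) → ℝ) (U W : Sq → Measure Z) : ℝ :=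
  ⨅ φ : {φ : unitInterval → unitInterval // IsMP φ ∧ Function.Bijective φ},
    d U (relabel W φ.val)

/-- Weak isomorphism of kernels: `U^φ = W^ψ` a.e. for some measure-preserving `φ, ψ`. -/
def WeakIso (U W : Sq → Measure Z) : Prop :=
  ∃ φ ψ : unitInterval → unitInterval, IsMP φ ∧ IsMP ψ ∧
    relabel U φ =ᵐ[(volume : Measure Sq)] relabel W ψ

/-- A family of kernels is tight if the family of measures `{M_W}` is tight. -/
def TightFamily (K : Set (Sq → Measure Z)) : Prop :=
  ∀ ε : ℝ≥0∞, 0 < ε → ∃ K₀ : Set Z, IsCompact K₀ ∧ ∀ W ∈ K, MW W K₀ᶜ ≤ ε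

/-- Invariance of a distance on probability-graphons under bijective
measure-preserving relabelings. -/
def Invariant (d : (Sq → Measure Z) → (Sq → Measure Z) → ℝ) : Prop :=
  ∀ U W : Sq → Measure Z, IsProbGraphon U → IsProbGraphon W →
    ∀ φ : unitInterval → unitInterval, IsMP φ → Function.Bijective φ →
      d (relabel U φ) (relabel W φ) = d U W

/-- Smoothness of a distance on probability-graphons: a.e. weak convergence implies
convergence in `d`. -/
def Smooth (d : (Sq → Measure Z) → (Sq → Measure Z) → ℝ) : Prop :=
  ∀ (Wn : ℕ → Sq → Measure Z) (W : Sq → Measure Z),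
    (∀ n, IsProbGraphon (Wn n)) → IsProbGraphon W →
    (∀ᵐ p ∂(volume : Measure Sq), WeakTendsto (fun n => Wn n p) (W p)) →
    Tendsto (fun n => d (Wn n) W) atTop (𝓝 0)

/-- `d` is a distance on the space `𝒲₁` of probability-graphons (where kernels that
agree a.e. are identified). -/
def IsGraphonDist (d : (Sq → Measure Z) → (Sq → Measure Z) → ℝ) : Prop :=
  (∀ U W, IsProbGraphon U → IsProbGraphon W → d U W = d W U) ∧
  (∀ U W, IsProbGraphon U → IsProbGraphon W → 0 ≤ d U W) ∧
  (∀ U V W, IsProbGraphon U → IsProbGraphon V → IsProbGraphon W → d U W ≤ d U V + d V W) ∧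
  (∀ U W, IsProbGraphon U → IsProbGraphon W →
    (d U W = 0 ↔ U =ᵐ[(volume : Measure Sq)] W))

/-- Distance axioms for `d` on a subset `M`. -/
def IsDistOnSet {α : Type*} (M : Set α) (d : α → α → ℝ) : Prop :=
  (∀ x ∈ M, ∀ y ∈ M, d x y = d y x) ∧
  (∀ x ∈ M, ∀ y ∈ M, 0 ≤ d x y) ∧
  (∀ x ∈ M, ∀ y ∈ M, ∀ z ∈ M, d x z ≤ d x y + d y z) ∧
  (∀ x ∈ M, ∀ y ∈ M, (d x y = 0 ↔ x = y))

/-- The set `ℳ≤1(Z)` of measures of total mass at most one. -/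
def SubProb (Z : Type*) [MeasurableSpace Z] : Set (Measure Z) := {μ | μ Set.univ ≤ 1}

/-- `d_m` is a distance on `ℳ≤1(Z)`. -/
def IsDistOnSubProb (dm : Measure Z → Measure Z → ℝ) : Prop :=
  IsDistOnSet (SubProb Z) dm

/-- `d_m` induces the weak topology on `ℳ≤1(Z)` (sequential formulation; the weak
topology on `ℳ≤1(Z)` is metrizable, so it is characterized by its convergent
sequences). -/
def InducesWeakTopologySub (dm : Measure Z → Measure Z → ℝ) : Prop :=
  ∀ (μn : ℕ → Measure Z) (μ : Measure Z), (∀ n, μn n ∈ SubProb Z) → μ ∈ SubProb Z →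
    (Tendsto (fun n => dm (μn n) μ) atTop (𝓝 0) ↔ WeakTendsto μn μ)

/-- Quasi-convexity of a distance on the convex set `ℳ₊(Z)` of finite measures. -/
def QuasiConvexPos (dm : Measure Z → Measure Z → ℝ) : Prop :=
  ∀ μ₁ μ₂ ν₁ ν₂ : Measure Z, IsFiniteMeasure μ₁ → IsFiniteMeasure μ₂ →
    IsFiniteMeasure ν₁ → IsFiniteMeasure ν₂ → ∀ a : ℝ≥0∞, a ≤ 1 →
    dm (a • μ₁ + (1 - a) • μ₂) (a • ν₁ + (1 - a) • ν₂) ≤ max (dm μ₁ ν₁) (dm μ₂ ν₂)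

/-! ### Finite partitions of `[0,1]` and the stepping operator -/

/-- A finite measurable partition of `[0,1]` (possibly with empty classes). -/
structure FinPartition : Type where
  n : ℕ
  part : Fin n → Set unitInterval
  measurableSet : ∀ i, MeasurableSet (part i)
  disjoint : ∀ i j, i ≠ j → Disjoint (part i) (part j)
  covers : (⋃ i, part i) = Set.univ

/-- `P` refines `Q`: every class of `P` is included in a class of `Q`. -/
def FinPartition.Refines (P Q : FinPartition) : Prop :=
  ∀ i, ∃ j, P.part i ⊆ Q.part j

/-- The stepping `W_𝒫` of a (positive) measure-valued kernel `W` with respect to a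
finite partition `𝒫`: on `S_i × S_j` it equals `W(S_i×S_j;·)/(λ(S_i)λ(S_j))`
(and the zero measure on classes of zero measure). -/
def stepping (W : Sq → Measure Z) (P : FinPartition) : Sq → Measure Z :=
  fun p => ∑ i : Fin P.n, ∑ j : Fin P.n,
    Set.indicator (P.part i ×ˢ P.part j)
      (fun _ => ((volume (P.part i)) * (volume (P.part j)))⁻¹ •
        kernelInt W (P.part i ×ˢ P.part j)) p

/-- Weak regularity of a distance on probability-graphons. -/
def WeaklyRegular (d : (Sq → Measure Z) → (Sq → Measure Z) → ℝ) : Prop :=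
  ∀ K : Set (Sq → Measure Z), (∀ W ∈ K, IsProbGraphon W) → TightFamily K →
    ∀ ε : ℝ, 0 < ε → ∃ m : ℕ, 0 < m ∧
      ∀ W ∈ K, ∀ Q : FinPartition, ∃ P : FinPartition,
        P.Refines Q ∧ P.n ≤ m * Q.n ∧ d W (stepping W P) < ε

/-- Regularity of a distance on probability-graphons with respect to the stepping
operator. -/
def SteppingRegular (d : (Sq → Measure Z) → (Sq → Measure Z) → ℝ) : Prop :=
  ∃ C₀ : ℝ, 0 < C₀ ∧ ∀ W U : Sq → Measure Z, IsProbGraphon W → IsProbGraphon U →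
    ∀ P : FinPartition, d W (stepping W P) ≤ C₀ * d W (stepping U P)

/-! ### Signed measure-valued kernels -/

/-- The signed measure associated with a finite measure (and junk value `0` on
non-finite measures). -/
def toSigned (μ : Measure Z) : SignedMeasure Z :=
  letI := Classical.dec (IsFiniteMeasure μ)
  if h : IsFiniteMeasure μ then @Measure.toSignedMeasure Z _ μ h else 0

/-- `W(A;·)` for a signed measure-valued kernel. -/
def skernelInt (W : Sq → SignedMeasure Z) (A : Set Sq) : SignedMeasure Z :=
  toSigned (((volume : Measure Sq).restrict A).bind
      fun p => (W p).toJordanDecomposition.posPart)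
    - toSigned (((volume : Measure Sq).restrict A).bind
      fun p => (W p).toJordanDecomposition.negPart)

/-- Total mass `‖s‖_TV` of the total variation of a signed measure. -/
def TVnorm (s : SignedMeasure Z) : ℝ≥0∞ := s.totalVariation Set.univ

/-- `‖W‖∞`, the essential supremum of the total variation masses of a signed
measure-valued kernel. -/
def TVbound (W : Sq → SignedMeasure Z) : ℝ≥0∞ :=
  essSup (fun p => TVnorm (W p)) (volume : Measure Sq)

/-- A signed measure-valued kernel: measurable in `(x,y)` and essentially bounded in
total variation. -/
def IsSignedKernel (W : Sq → SignedMeasure Z) : Prop :=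
  (∀ A : Set Z, MeasurableSet A → Measurable fun p => W p A) ∧ TVbound W < ⊤

/-- The measure `M_W = ∫ |W|(x,y;·) dx dy` of a signed measure-valued kernel. -/
def MWs (W : Sq → SignedMeasure Z) : Measure Z :=
  (volume : Measure Sq).bind fun p => (W p).totalVariation

/-- Tightness for a family of signed measure-valued kernels. -/
def TightFamilyS (K : Set (Sq → SignedMeasure Z)) : Prop :=
  ∀ ε : ℝ≥0∞, 0 < ε → ∃ K₀ : Set Z, IsCompact K₀ ∧ ∀ W ∈ K, MWs W K₀ᶜ ≤ ε

/-- Integral of a bounded continuous function against a signed measure. -/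
def sint (f : BoundedContinuousFunction Z ℝ) (s : SignedMeasure Z) : ℝ :=
  ∫ x, f x ∂s.toJordanDecomposition.posPart - ∫ x, f x ∂s.toJordanDecomposition.negPart

/-- Weak convergence of signed measures. -/
def WeakTendstoS (s : ℕ → SignedMeasure Z) (t : SignedMeasure Z) : Prop :=
  ∀ f : BoundedContinuousFunction Z ℝ,
    Tendsto (fun n => sint f (s n)) atTop (𝓝 (sint f t))

/-- Stepping of a signed measure-valued kernel with respect to a finite partition. -/
def steppingS (W : Sq → SignedMeasure Z) (P : FinPartition) : Sq → SignedMeasure Z :=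
  fun p => ∑ i : Fin P.n, ∑ j : Fin P.n,
    Set.indicator (P.part i ×ˢ P.part j)
      (fun _ => (((volume (P.part i)).toReal * (volume (P.part j)).toReal)⁻¹ : ℝ) •
        skernelInt W (P.part i ×ˢ P.part j)) p

/-- Cut distance for signed measure-valued kernels associated with a distance `d_m`
on signed measures. -/
def cutDistS (dm : SignedMeasure Z → SignedMeasure Z → ℝ) (U W : Sq → SignedMeasure Z) : ℝ :=
  ⨆ ST : {p : Set unitInterval × Set unitInterval // MeasurableSet p.1 ∧ MeasurableSet p.2},
    dm (skernelInt U (ST.val.1 ×ˢ ST.val.2)) (skernelInt W (ST.val.1 ×ˢ ST.val.2))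

/-- Quasi-convexity of a distance on a convex subset `M` of signed measures. -/
def QuasiConvexOn (M : Set (SignedMeasure Z)) (dm : SignedMeasure Z → SignedMeasure Z → ℝ) :
    Prop :=
  ∀ x₁ ∈ M, ∀ x₂ ∈ M, ∀ y₁ ∈ M, ∀ y₂ ∈ M, ∀ a : ℝ, 0 ≤ a → a ≤ 1 →
    dm (a • x₁ + (1 - a) • x₂) (a • y₁ + (1 - a) • y₂) ≤ max (dm x₁ y₁) (dm x₂ y₂)

/-! ### Convergence determining sequences and the associated norms -/

/-- `F` is a convergence determining sequence: `[0,1]`-valued bounded continuous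
functions, `F 0 = 1`, such that convergence of all moments `μ(f_k)` implies weak
convergence (for finite positive measures). -/
def IsConvDet (F : ℕ → BoundedContinuousFunction Z ℝ) : Prop :=
  F 0 = 1 ∧ (∀ k x, F k x ∈ Set.Icc (0:ℝ) 1) ∧
  ∀ (μn : ℕ → Measure Z) (μ : Measure Z), (∀ n, IsFiniteMeasure (μn n)) → IsFiniteMeasure μ →
    (∀ k, Tendsto (fun n => ∫ x, F k x ∂(μn n)) atTop (𝓝 (∫ x, F k x ∂μ))) →
    WeakTendsto μn μ

/-- `‖μ − ν‖_F = Σ_k 2^{-k} |μ(f_k) − ν(f_k)|` for positive measures. -/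
def Fdist (F : ℕ → BoundedContinuousFunction Z ℝ) (μ ν : Measure Z) : ℝ :=
  ∑' k : ℕ, (1/2 : ℝ) ^ k * |∫ x, F k x ∂μ - ∫ x, F k x ∂ν|

/-- The cut distance `d_{□,F}(U,W) = ‖U − W‖_{□,F}` on measure-valued kernels. -/
def cutDistF (F : ℕ → BoundedContinuousFunction Z ℝ) (U W : Sq → Measure Z) : ℝ :=
  ⨆ ST : {p : Set unitInterval × Set unitInterval // MeasurableSet p.1 ∧ MeasurableSet p.2},
    Fdist F (kernelInt U (ST.val.1 ×ˢ ST.val.2)) (kernelInt W (ST.val.1 ×ˢ ST.val.2))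

/-- The norm `‖s‖_F` of a signed measure. -/
def FnormS (F : ℕ → BoundedContinuousFunction Z ℝ) (s : SignedMeasure Z) : ℝ :=
  ∑' k : ℕ, (1/2 : ℝ) ^ k * |sint (F k) s|

/-- The cut norm `‖W‖_{□,F}` of a signed measure-valued kernel. -/
def cutNormFS (F : ℕ → BoundedContinuousFunction Z ℝ) (W : Sq → SignedMeasure Z) : ℝ :=
  ⨆ ST : {p : Set unitInterval × Set unitInterval // MeasurableSet p.1 ∧ MeasurableSet p.2},
    FnormS F (skernelInt W (ST.val.1 ×ˢ ST.val.2))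

/-- The norm `‖W‖_{2,F}` of a signed measure-valued kernel. -/
def norm2F (F : ℕ → BoundedContinuousFunction Z ℝ) (W : Sq → SignedMeasure Z) : ℝ :=
  Real.sqrt (∑' k : ℕ, (1/2 : ℝ) ^ k * ∫ p, (sint (F k) (W p)) ^ 2 ∂(volume : Measure Sq))

/-! ### Homomorphism densities and sampling -/

/-- The homomorphism density `t(F^g, W)` of a `C_b(Z)`-decorated finite directed graph
with vertex set `Fin v` and edge set `E` in a measure-valued kernel `W`. -/
def homDensity {v : ℕ} (E : Finset (Fin v × Fin v))
    (g : Fin v × Fin v → BoundedContinuousFunction Z ℝ) (W : Sq → Measure Z) : ℝ :=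
  ∫ x : Fin v → unitInterval,
    (∏ e ∈ E, ∫ z, g e z ∂(W (x e.1, x e.2))) ∂(volume : Measure (Fin v → unitInterval))

/-- The edge set of the complete directed graph on `k` vertices. -/
def completeEdges (k : ℕ) : Finset (Fin k × Fin k) :=
  Finset.univ.filter fun e => e.1 ≠ e.2

/-- The `i`-th step `((i)/k, (i+1)/k]` of the uniform partition of `[0,1]` into `k`
intervals. -/
def stepSet (k : ℕ) (i : Fin k) : Set unitInterval :=
  {t | (i : ℝ) / k < (t : ℝ) ∧ (t : ℝ) ≤ ((i : ℝ) + 1) / k}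

/-- The stepfunction `W_x` sampled from `W` at the points `x = (x₁, …, x_k)`. -/
def sample (W : Sq → Measure Z) {k : ℕ} (x : Fin k → unitInterval) : Sq → Measure Z :=
  fun p => ∑ i : Fin k, ∑ j : Fin k,
    Set.indicator (stepSet k i ×ˢ stepSet k j) (fun _ => W (x i, x j)) p

/-- The probability-graphon associated with the `Z`-weighted complete graph on `k`
vertices with weights `β`. -/
def graphonOfWeights {k : ℕ} (β : Fin k × Fin k → Z) : Sq → Measure Z :=
  fun p => ∑ i : Fin k, ∑ j : Fin k,
    Set.indicator (stepSet k i ×ˢ stepSet k j) (fun _ => Measure.dirac (β (i, j))) p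

/-- The joint law of `(X, (β_{ij}))` where `X` is uniform on `[0,1]^k` and, given `X`,
the weights `β_{ij}` are independent with respective laws `W(X_i, X_j;·)`. -/
def sampleLaw (W : Sq → Measure Z) (k : ℕ) :
    Measure ((Fin k → unitInterval) × (Fin k × Fin k → Z)) :=
  (volume : Measure (Fin k → unitInterval)).bind fun x =>
    (Measure.pi fun e : Fin k × Fin k => W (x e.1, x e.2)).map (Prod.mk x)


section SignedMeasureLemmas

variable {α Ω : Type*} [MeasurableSpace α] [MeasurableSpace Ω]

theorem posPart_add_eq_add_negPart {s : SignedMeasure α} {μ ν : Measure α}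
    [IsFiniteMeasure μ] [IsFiniteMeasure ν] (h : s = μ.toSignedMeasure - ν.toSignedMeasure) :
    s.toJordanDecomposition.posPart + ν = μ + s.toJordanDecomposition.negPart := by
  rw [← Measure.toSignedMeasure_eq_toSignedMeasure_iff, Measure.toSignedMeasure_add,
    Measure.toSignedMeasure_add, ← sub_eq_sub_iff_add_eq_add, ← h]
  exact s.toSignedMeasure_toJordanDecomposition

theorem eq_posPart_sub_negPart (s : SignedMeasure α) :
    s = s.toJordanDecomposition.posPart.toSignedMeasure
      - s.toJordanDecomposition.negPart.toSignedMeasure :=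
  s.toSignedMeasure_toJordanDecomposition.symm

theorem exists_posPart_real_eq (s : SignedMeasure α) :
    ∃ i : Set α, MeasurableSet i ∧ ∀ A, MeasurableSet A →
      s.toJordanDecomposition.posPart.real A = s (i ∩ A) := by
  obtain ⟨i, hi₁, hi₂, hi₃, hμ, -⟩ := s.toJordanDecomposition_spec
  refine ⟨i, hi₁, fun A hA => ?_⟩
  rw [hμ, SignedMeasure.toMeasureOfZeroLE_real_apply _ hi₂ hi₁ hA]

theorem apply_le_posPart_real (s : SignedMeasure α) {A : Set α} (hA : MeasurableSet A) :
    s A ≤ s.toJordanDecomposition.posPart.real A := by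
  rw [s.apply_eq_posPart_real_sub_negPart_real hA]
  linarith [measureReal_nonneg (μ := s.toJordanDecomposition.negPart) (s := A)]

theorem posPart_eq_iSup (s : SignedMeasure α) {𝒜 : Set (Set α)} (h𝒜 : IsSetAlgebra 𝒜)
    (hgen : ‹MeasurableSpace α› = MeasurableSpace.generateFrom 𝒜) {A : Set α}
    (hA : MeasurableSet A) :
    s.toJordanDecomposition.posPart A = ⨆ B ∈ 𝒜, ENNReal.ofReal (s (B ∩ A)) := by
  set P := s.toJordanDecomposition.posPart with hP
  set N := s.toJordanDecomposition.negPart with hN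
  have hdense : (P + N).MeasureDense 𝒜 :=
    Measure.MeasureDense.of_generateFrom_isSetAlgebra_finite (P + N) h𝒜 hgen
  apply le_antisymm
  · refine ENNReal.le_of_forall_pos_le_add fun ε hε _ => ?_
    obtain ⟨i, hi, hs⟩ := exists_posPart_real_eq s
    obtain ⟨B, hB, hlt⟩ := hdense.approx i hi (measure_ne_top _ _) ε hε
    have hBm := hdense.measurable B hB
    have hlt' : (P + N).real (symmDiff i B) ≤ ε :=
      ENNReal.toReal_le_of_le_ofReal ε.2 hlt.le
    rw [measureReal_add_apply] at hlt'
    have h1 : P.real (i ∩ A) ≤ P.real (B ∩ A) + P.real (symmDiff i B) := by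
      refine (measureReal_mono ?_).trans (measureReal_union_le _ _)
      rintro x ⟨hx, hxA⟩
      by_cases hxB : x ∈ B
      · exact Or.inl ⟨hxB, hxA⟩
      · exact Or.inr (Or.inl ⟨hx, hxB⟩)
    have h2 : N.real (B ∩ A) ≤ N.real (i ∩ A) + N.real (symmDiff i B) := by
      refine (measureReal_mono ?_).trans (measureReal_union_le _ _)
      rintro x ⟨hx, hxA⟩
      by_cases hxi : x ∈ i
      · exact Or.inl ⟨hxi, hxA⟩
      · exact Or.inr (Or.inr ⟨hx, hxi⟩)
    have h3 : P.real A ≤ s (B ∩ A) + ε := by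
      rw [hP, hs A hA, s.apply_eq_posPart_real_sub_negPart_real (hi.inter hA),
        s.apply_eq_posPart_real_sub_negPart_real (hBm.inter hA)]
      linarith
    calc P A = ENNReal.ofReal (P.real A) := (ofReal_measureReal).symm
      _ ≤ ENNReal.ofReal (s (B ∩ A) + ε) := ENNReal.ofReal_le_ofReal h3
      _ ≤ ENNReal.ofReal (s (B ∩ A)) + ENNReal.ofReal ε := ENNReal.ofReal_add_le
      _ ≤ _ := by
        rw [ENNReal.ofReal_coe_nnreal]
        gcongr
        exact le_iSup₂ (f := fun B (_ : B ∈ 𝒜) => ENNReal.ofReal (s (B ∩ A))) B hB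
  · refine iSup₂_le fun B hB => ?_
    refine (ENNReal.ofReal_le_ofReal
      (apply_le_posPart_real s ((hdense.measurable B hB).inter hA))).trans ?_
    rw [ofReal_measureReal]
    exact measure_mono Set.inter_subset_right

theorem measurable_posPart [MeasurableSpace.CountablyGenerated α] {W : Ω → SignedMeasure α}
    (hW : ∀ A, MeasurableSet A → Measurable fun p => W p A) :
    Measurable fun p => (W p).toJordanDecomposition.posPart := by
  have hc := MeasurableSpace.countable_countableGeneratingSet (α := α)
  have hgen : ‹MeasurableSpace α› = MeasurableSpace.generateFrom
      (generateSetAlgebra (MeasurableSpace.countableGeneratingSet α)) := by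
    rw [generateFrom_generateSetAlgebra_eq, MeasurableSpace.generateFrom_countableGeneratingSet]
  refine Measure.measurable_of_measurable_coe _ fun A hA => ?_
  simp_rw [fun p => posPart_eq_iSup (W p) isSetAlgebra_generateSetAlgebra hgen hA]
  refine Measurable.biSup _ (countable_generateSetAlgebra hc) fun B hB => ?_
  refine (hW _ (MeasurableSet.inter ?_ hA)).ennreal_ofReal
  rw [hgen]
  exact MeasurableSpace.measurableSet_generateFrom hB

theorem measurable_negPart [MeasurableSpace.CountablyGenerated α] {W : Ω → SignedMeasure α}
    (hW : ∀ A, MeasurableSet A → Measurable fun p => W p A) :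
    Measurable fun p => (W p).toJordanDecomposition.negPart := by
  have h := measurable_posPart (W := fun p => -W p) fun A hA => (hW A hA).neg
  simpa only [SignedMeasure.toJordanDecomposition_neg, JordanDecomposition.neg_posPart] using h

theorem posPart_real_univ_le {s : SignedMeasure α} {C : ℝ} (h : ∀ A, |s A| ≤ C) :
    s.toJordanDecomposition.posPart.real Set.univ ≤ C := by
  obtain ⟨i, -, hs⟩ := exists_posPart_real_eq s
  rw [hs _ MeasurableSet.univ]
  exact (le_abs_self _).trans (h _)

theorem negPart_real_univ_le {s : SignedMeasure α} {C : ℝ} (h : ∀ A, |s A| ≤ C) :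
    s.toJordanDecomposition.negPart.real Set.univ ≤ C := by
  have := posPart_real_univ_le (s := -s) (C := C) (by simpa using h)
  simpa only [SignedMeasure.toJordanDecomposition_neg, JordanDecomposition.neg_posPart] using this

theorem abs_apply_le_totalVariation (s : SignedMeasure α) (A : Set α) :
    |s A| ≤ s.totalVariation.real Set.univ := by
  by_cases hA : MeasurableSet A
  · have h : s.totalVariation.real Set.univ = s.toJordanDecomposition.posPart.real Set.univ
        + s.toJordanDecomposition.negPart.real Set.univ := by
      rw [SignedMeasure.totalVariation, measureReal_add_apply]
    rw [h, s.apply_eq_posPart_real_sub_negPart_real hA]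
    have h1 : s.toJordanDecomposition.posPart.real A
        ≤ s.toJordanDecomposition.posPart.real Set.univ := measureReal_mono (Set.subset_univ A)
    have h2 : s.toJordanDecomposition.negPart.real A
        ≤ s.toJordanDecomposition.negPart.real Set.univ := measureReal_mono (Set.subset_univ A)
    have h3 : 0 ≤ s.toJordanDecomposition.posPart.real A := measureReal_nonneg
    have h4 : 0 ≤ s.toJordanDecomposition.negPart.real A := measureReal_nonneg
    rw [abs_le]
    constructor <;> linarith
  · rw [s.not_measurable hA, abs_zero]
    exact measureReal_nonneg

theorem isFiniteMeasure_bind {μ : Measure Ω} [IsFiniteMeasure μ] {κ : Ω → Measure α}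
    [∀ p, IsFiniteMeasure (κ p)] (hκ : Measurable κ) {C : ℝ}
    (hC : ∀ᵐ p ∂μ, (κ p).real Set.univ ≤ C) : IsFiniteMeasure (μ.bind κ) := by
  refine ⟨?_⟩
  rw [Measure.bind_apply MeasurableSet.univ hκ.aemeasurable]
  calc ∫⁻ p, κ p Set.univ ∂μ ≤ ∫⁻ _, ENNReal.ofReal C ∂μ := by
        refine lintegral_mono_ae (hC.mono fun p hp => ?_)
        rw [← ofReal_measureReal]
        exact ENNReal.ofReal_le_ofReal hp
    _ < ⊤ := by
        rw [lintegral_const]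
        exact ENNReal.mul_lt_top ENNReal.ofReal_lt_top (measure_lt_top _ _)

theorem integrable_of_unitInterval_valued {μ : Measure α} [IsFiniteMeasure μ] {f : α → ℝ}
    (hf : Measurable f) (h01 : ∀ x, f x ∈ Set.Icc (0 : ℝ) 1) : Integrable f μ :=
  Integrable.of_bound hf.aestronglyMeasurable 1 (ae_of_all _ fun x => by
    rw [Real.norm_eq_abs, abs_le]
    exact ⟨by linarith [(h01 x).1], (h01 x).2⟩)

theorem integral_mem_Icc_of_unitInterval_valued {μ : Measure α} [IsFiniteMeasure μ] {f : α → ℝ}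
    (hf : Measurable f) (h01 : ∀ x, f x ∈ Set.Icc (0 : ℝ) 1) :
    ∫ x, f x ∂μ ∈ Set.Icc 0 (μ.real Set.univ) := by
  refine ⟨integral_nonneg fun x => (h01 x).1, ?_⟩
  calc ∫ x, f x ∂μ ≤ ∫ _, (1 : ℝ) ∂μ :=
        integral_mono (integrable_of_unitInterval_valued hf h01) (integrable_const _)
          fun x => (h01 x).2
    _ = μ.real Set.univ := by simp

theorem measurable_integral_of_unitInterval_valued {κ : Ω → Measure α}
    (hκ : Measurable κ) {f : α → ℝ} (hf : Measurable f) (h01 : ∀ x, f x ∈ Set.Icc (0 : ℝ) 1) :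
    Measurable fun p => ∫ x, f x ∂κ p := by
  simp_rw [fun p => integral_eq_lintegral_of_nonneg_ae (μ := κ p)
    (ae_of_all _ fun x => (h01 x).1) hf.aestronglyMeasurable]
  exact ((Measure.measurable_lintegral hf.ennreal_ofReal).comp hκ).ennreal_toReal

theorem integral_bind_of_unitInterval_valued {μ : Measure Ω} {κ : Ω → Measure α}
    [∀ p, IsFiniteMeasure (κ p)] (hκ : Measurable κ) {f : α → ℝ} (hf : Measurable f)
    (h01 : ∀ x, f x ∈ Set.Icc (0 : ℝ) 1) :
    ∫ x, f x ∂(μ.bind κ) = ∫ p, ∫ x, f x ∂κ p ∂μ := by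
  rw [integral_eq_lintegral_of_nonneg_ae (ae_of_all _ fun x => (h01 x).1)
      hf.aestronglyMeasurable,
    integral_eq_lintegral_of_nonneg_ae (ae_of_all _ fun p => integral_nonneg fun x => (h01 x).1)
      (measurable_integral_of_unitInterval_valued hκ hf h01).aestronglyMeasurable,
    Measure.lintegral_bind hκ.aemeasurable hf.ennreal_ofReal.aemeasurable]
  congr 1
  refine lintegral_congr fun p => ?_
  rw [ofReal_integral_eq_lintegral_ofReal (integrable_of_unitInterval_valued hf h01)
    (ae_of_all _ fun x => (h01 x).1)]

end SignedMeasureLemmas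

section SignedIntegral

theorem sint_smul (f : BoundedContinuousFunction Z ℝ) (c : ℝ) (s : SignedMeasure Z) :
    sint f (c • s) = c * sint f s := by
  rw [sint, sint, SignedMeasure.toJordanDecomposition_smul_real]
  rcases le_or_gt 0 c with hc | hc
  · rw [JordanDecomposition.real_smul_posPart_nonneg _ _ hc,
      JordanDecomposition.real_smul_negPart_nonneg _ _ hc, integral_smul_nnreal_measure,
      integral_smul_nnreal_measure, NNReal.smul_def, NNReal.smul_def, Real.coe_toNNReal _ hc,
      smul_eq_mul, smul_eq_mul, mul_sub]
  · rw [JordanDecomposition.real_smul_posPart_neg _ _ hc,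
      JordanDecomposition.real_smul_negPart_neg _ _ hc, integral_smul_nnreal_measure,
      integral_smul_nnreal_measure, NNReal.smul_def, NNReal.smul_def,
      Real.coe_toNNReal _ (neg_pos.2 hc).le, smul_eq_mul, smul_eq_mul]
    ring

variable [OpensMeasurableSpace Z]

theorem sint_eq_of_eq_sub (f : BoundedContinuousFunction Z ℝ) {s : SignedMeasure Z}
    {μ ν : Measure Z} [IsFiniteMeasure μ] [IsFiniteMeasure ν]
    (h : s = μ.toSignedMeasure - ν.toSignedMeasure) :
    sint f s = ∫ x, f x ∂μ - ∫ x, f x ∂ν := by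
  have h' := congrArg (fun m : Measure Z => ∫ x, f x ∂m) (posPart_add_eq_add_negPart h)
  simp only [integral_add_measure (f.integrable _) (f.integrable _)] at h'
  rw [sint]
  linarith

theorem sint_add (f : BoundedContinuousFunction Z ℝ) (s t : SignedMeasure Z) :
    sint f (s + t) = sint f s + sint f t := by
  have h : s + t =
      (s.toJordanDecomposition.posPart + t.toJordanDecomposition.posPart).toSignedMeasure
      - (s.toJordanDecomposition.negPart + t.toJordanDecomposition.negPart).toSignedMeasure := by
    rw [Measure.toSignedMeasure_add, Measure.toSignedMeasure_add, add_sub_add_comm,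
      ← eq_posPart_sub_negPart, ← eq_posPart_sub_negPart]
  rw [sint_eq_of_eq_sub f h, integral_add_measure (f.integrable _) (f.integrable _),
    integral_add_measure (f.integrable _) (f.integrable _), sint, sint]
  ring

theorem sint_sub (f : BoundedContinuousFunction Z ℝ) (s t : SignedMeasure Z) :
    sint f (s - t) = sint f s - sint f t := by
  rw [sub_eq_add_neg, sint_add, ← neg_one_smul ℝ t, sint_smul]
  ring

end SignedIntegral

section FiberAverage

variable {Ω ι : Type*} [MeasurableSpace Ω]

/-- The average of `f` over the fiber of `d` through a given point. -/
def fiberAverage (μ : Measure Ω) (d : Ω → ι) (f : Ω → ℝ) (p : Ω) : ℝ :=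
  ⨍ x in d ⁻¹' {d p}, f x ∂μ

theorem fiberAverage_comp_injective {κ : Type*} (μ : Measure Ω) (d : Ω → ι) {e : ι → κ}
    (he : Function.Injective e) (f : Ω → ℝ) :
    fiberAverage μ (e ∘ d) f = fiberAverage μ d f := by
  ext p
  have h : (e ∘ d) ⁻¹' {(e ∘ d) p} = d ⁻¹' {d p} := by
    ext x
    simp [he.eq_iff]
  rw [fiberAverage, fiberAverage, h]

variable [Finite ι] [MeasurableSpace ι] [MeasurableSingletonClass ι]
  {μ : Measure Ω} [IsFiniteMeasure μ] {d : Ω → ι}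

theorem memLp_of_factorsThrough (hd : Measurable d) {h : Ω → ℝ}
    (hh : Function.FactorsThrough h d) : MemLp h 2 μ := by
  obtain ⟨C, hC⟩ := (Set.finite_range fun i => ‖Function.extend d h 0 i‖).bddAbove
  have he : ∀ p, h p = Function.extend d h 0 (d p) := fun p => (hh.extend_apply 0 p).symm
  have hm : Measurable h := by
    have : h = Function.extend d h 0 ∘ d := funext he
    rw [this]
    exact (measurable_of_finite _).comp hd
  refine MemLp.of_bound hm.aestronglyMeasurable C (ae_of_all _ fun p => ?_)
  rw [he p]
  exact hC ⟨d p, rfl⟩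

omit [Finite ι] [MeasurableSpace ι] [MeasurableSingletonClass ι] [IsFiniteMeasure μ] in
theorem factorsThrough_fiberAverage (f : Ω → ℝ) :
    Function.FactorsThrough (fiberAverage μ d f) d := fun p q h => by
  rw [fiberAverage, fiberAverage, h]

theorem integral_sub_fiberAverage_mul (hd : Measurable d) {f h : Ω → ℝ} (hf : MemLp f 2 μ)
    (hh : Function.FactorsThrough h d) :
    ∫ p, (f p - fiberAverage μ d f p) * h p ∂μ = 0 := by
  have hS : ∀ i, MeasurableSet (d ⁻¹' {i}) := fun i => hd (measurableSet_singleton i)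
  have hint : Integrable (fun p => (f p - fiberAverage μ d f p) * h p) μ :=
    (hf.sub (memLp_of_factorsThrough hd (factorsThrough_fiberAverage f))).integrable_mul
      (memLp_of_factorsThrough hd hh)
  have := Fintype.ofFinite ι
  have hU : (⋃ i, d ⁻¹' {i}) = Set.univ := by
    ext x
    simp
  rw [← setIntegral_univ, ← hU, integral_iUnion_fintype hS
    (fun i j hij => Disjoint.preimage d (Set.disjoint_singleton.2 hij))
    fun i => hint.integrableOn]
  refine Finset.sum_eq_zero fun i _ => ?_
  have heq : ∫ p in d ⁻¹' {i}, (f p - fiberAverage μ d f p) * h p ∂μ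
      = ∫ p in d ⁻¹' {i}, (f p - ⨍ x in d ⁻¹' {i}, f x ∂μ) * Function.extend d h 0 i ∂μ := by
    refine setIntegral_congr_fun (hS i) fun p hp => ?_
    have hp' : d p = i := hp
    subst hp'
    simp only [hh.extend_apply]
    rfl
  rw [heq, integral_mul_const, integral_sub_average, zero_mul]

theorem integral_sub_fiberAverage_sq_le (hd : Measurable d) {f h : Ω → ℝ} (hf : MemLp f 2 μ)
    (hh : Function.FactorsThrough h d) :
    ∫ p, (f p - fiberAverage μ d f p) ^ 2 ∂μ ≤ ∫ p, (f p - h p) ^ 2 ∂μ := by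
  have hav : Function.FactorsThrough (fiberAverage μ d f) d := factorsThrough_fiberAverage f
  have hA : MemLp (fiberAverage μ d f) 2 μ := memLp_of_factorsThrough hd hav
  have hH : MemLp h 2 μ := memLp_of_factorsThrough hd hh
  have hg : Function.FactorsThrough (fun p => 2 * (fiberAverage μ d f p - h p)) d :=
    fun p q hpq => by simp only [hav hpq, hh hpq]
  have h0 := integral_sub_fiberAverage_mul hd hf hg
  have hi1 : Integrable (fun p => (f p - fiberAverage μ d f p) ^ 2) μ := (hf.sub hA).integrable_sq
  have hi2 : Integrable (fun p => (fiberAverage μ d f p - h p) ^ 2) μ := (hA.sub hH).integrable_sq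
  have hi3 : Integrable (fun p => (f p - fiberAverage μ d f p)
      * (2 * (fiberAverage μ d f p - h p))) μ :=
    (hf.sub hA).integrable_mul (memLp_of_factorsThrough hd hg)
  have hi4 : Integrable (fun p => (f p - fiberAverage μ d f p) ^ 2
      + (fiberAverage μ d f p - h p) ^ 2) μ := hi1.add hi2
  have hexp : ∫ p, (f p - h p) ^ 2 ∂μ = ∫ p, (f p - fiberAverage μ d f p) ^ 2 ∂μ
      + ∫ p, (fiberAverage μ d f p - h p) ^ 2 ∂μ := by
    rw [← add_zero (∫ p, (f p - fiberAverage μ d f p) ^ 2 ∂μ + _), ← h0,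
      ← integral_add hi1 hi2, ← integral_add hi4 hi3]
    refine integral_congr_ae (ae_of_all _ fun p => ?_)
    ring
  rw [hexp]
  exact le_add_of_nonneg_right (integral_nonneg fun p => sq_nonneg _)

end FiberAverage

section EnergyIncrement

/-- The labelling of `[0,1]²` by pairs induced by a labelling of `[0,1]`. -/
def pairLabel {ι : Type*} (c : unitInterval → ι) (p : Sq) : ι × ι := (c p.1, c p.2)

theorem measurable_pairLabel {ι : Type*} [MeasurableSpace ι] {c : unitInterval → ι}
    (hc : Measurable c) : Measurable (pairLabel c) :=
  (hc.comp measurable_fst).prodMk (hc.comp measurable_snd)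

/-- The squared `‖·‖_{2,F}`-distance of a family of functions to its stepping. -/
def stepEnergy {N : ℕ} (w : ℕ → Sq → ℝ) (c : unitInterval → Fin N) : ℝ :=
  ∑' n, (1 / 2 : ℝ) ^ n *
    ∫ p, (w n p - fiberAverage volume (pairLabel c) (w n) p) ^ 2 ∂(volume : Measure Sq)

/-- The cut norm of the difference between a family of functions and its stepping is at
most `B`. -/
def CutClose {N : ℕ} (w : ℕ → Sq → ℝ) (c : unitInterval → Fin N) (B : ℝ) : Prop :=
  ∀ S T : Set unitInterval, MeasurableSet S → MeasurableSet T →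
    ∑' n, (1 / 2 : ℝ) ^ n *
      |∫ p in S ×ˢ T, (w n p - fiberAverage volume (pairLabel c) (w n) p)| ≤ B

theorem exists_refinement {N : ℕ} {c : unitInterval → Fin N} (hc : Measurable c)
    {S T : Set unitInterval} (hS : MeasurableSet S) (hT : MeasurableSet T) :
    ∃ c' : unitInterval → Fin (N * 4), Measurable c' ∧
      ∀ x y, c' x = c' y → c x = c y ∧ (x ∈ S ↔ y ∈ S) ∧ (x ∈ T ↔ y ∈ T) := by
  classical
  set b : unitInterval → Fin 4 :=
    fun x => if x ∈ S then (if x ∈ T then 0 else 1) else (if x ∈ T then 2 else 3) with hb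
  have hbm : Measurable b :=
    Measurable.ite hS (Measurable.ite hT measurable_const measurable_const)
      (Measurable.ite hT measurable_const measurable_const)
  refine ⟨fun x => finProdFinEquiv (c x, b x),
    (measurable_of_finite _).comp (hc.prodMk hbm), fun x y hxy => ?_⟩
  obtain ⟨h1, h2⟩ := Prod.mk.inj (finProdFinEquiv.injective hxy)
  refine ⟨h1, ?_⟩
  simp only [hb] at h2
  by_cases hxS : x ∈ S <;> by_cases hxT : x ∈ T <;> by_cases hyS : y ∈ S <;>
    by_cases hyT : y ∈ T <;> simp_all

variable {w : ℕ → Sq → ℝ} {C : ℝ}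

theorem memLp_two_of_ae_bound {f : Sq → ℝ} (hf : Measurable f)
    (hC : ∀ᵐ p ∂(volume : Measure Sq), |f p| ≤ C) : MemLp f 2 (volume : Measure Sq) :=
  MemLp.of_bound hf.aestronglyMeasurable C hC

theorem integral_sq_le_of_ae_bound {f : Sq → ℝ}
    (hf : Measurable f) (hC : ∀ᵐ p ∂(volume : Measure Sq), |f p| ≤ C) :
    ∫ p, f p ^ 2 ∂(volume : Measure Sq) ≤ C ^ 2 := by
  calc ∫ p, f p ^ 2 ∂(volume : Measure Sq) ≤ ∫ _, C ^ 2 ∂(volume : Measure Sq) := by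
        refine integral_mono_ae (memLp_two_of_ae_bound hf hC).integrable_sq (integrable_const _)
          (hC.mono fun p hp => ?_)
        exact sq_le_sq' (abs_le.1 hp).1 (abs_le.1 hp).2
    _ = C ^ 2 := by simp

theorem summable_geometric_mul {a : ℕ → ℝ} {K : ℝ} (h0 : ∀ n, 0 ≤ a n) (hK : ∀ n, a n ≤ K) :
    Summable fun n => (1 / 2 : ℝ) ^ n * a n :=
  Summable.of_nonneg_of_le (fun n => mul_nonneg (by positivity) (h0 n))
    (fun n => mul_le_mul_of_nonneg_left (hK n) (by positivity))
    (summable_geometric_two.mul_right K)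

theorem integral_sub_fiberAverage_sq_le_integral_sq {N : ℕ} {f : Sq → ℝ}
    (hf : MemLp f 2 (volume : Measure Sq)) {c : unitInterval → Fin N} (hc : Measurable c) :
    ∫ p, (f p - fiberAverage volume (pairLabel c) f p) ^ 2 ∂(volume : Measure Sq)
      ≤ ∫ p, f p ^ 2 ∂(volume : Measure Sq) := by
  have h := integral_sub_fiberAverage_sq_le (measurable_pairLabel hc) hf (h := fun _ => 0)
    fun _ _ _ => rfl
  simpa only [sub_zero] using h

theorem summable_stepEnergy {N : ℕ} (hw : ∀ n, Measurable (w n))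
    (hC : ∀ n, ∀ᵐ p ∂(volume : Measure Sq), |w n p| ≤ C) {c : unitInterval → Fin N}
    (hc : Measurable c) :
    Summable fun n => (1 / 2 : ℝ) ^ n *
      ∫ p, (w n p - fiberAverage volume (pairLabel c) (w n) p) ^ 2 ∂(volume : Measure Sq) :=
  summable_geometric_mul (fun _ => integral_nonneg fun _ => sq_nonneg _)
    fun n => (integral_sub_fiberAverage_sq_le_integral_sq
      (memLp_two_of_ae_bound (hw n) (hC n)) hc).trans (integral_sq_le_of_ae_bound (hw n) (hC n))

theorem summable_integral_sq (hw : ∀ n, Measurable (w n))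
    (hC : ∀ n, ∀ᵐ p ∂(volume : Measure Sq), |w n p| ≤ C) :
    Summable fun n => (1 / 2 : ℝ) ^ n * ∫ p, w n p ^ 2 ∂(volume : Measure Sq) :=
  summable_geometric_mul (fun _ => integral_nonneg fun _ => sq_nonneg _)
    fun n => integral_sq_le_of_ae_bound (hw n) (hC n)

theorem stepEnergy_le {N : ℕ} (hw : ∀ n, Measurable (w n))
    (hC : ∀ n, ∀ᵐ p ∂(volume : Measure Sq), |w n p| ≤ C) {c : unitInterval → Fin N}
    (hc : Measurable c) :
    stepEnergy w c ≤ ∑' n, (1 / 2 : ℝ) ^ n * ∫ p, w n p ^ 2 ∂(volume : Measure Sq) :=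
  (summable_stepEnergy hw hC hc).tsum_le_tsum
    (fun n => mul_le_mul_of_nonneg_left (integral_sub_fiberAverage_sq_le_integral_sq
      (memLp_two_of_ae_bound (hw n) (hC n)) hc) (by positivity))
    (summable_integral_sq hw hC)

theorem stepEnergy_nonneg {N : ℕ} (w : ℕ → Sq → ℝ) (c : unitInterval → Fin N) :
    0 ≤ stepEnergy w c :=
  tsum_nonneg fun n => mul_nonneg (by positivity) (integral_nonneg fun p => sq_nonneg _)

theorem integral_sub_smul_indicator_sq_le {g : Sq → ℝ} (hg : MemLp g 2 (volume : Measure Sq))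
    {A : Set Sq} (hA : MeasurableSet A) (t : ℝ) :
    ∫ p, (g p - t * A.indicator 1 p) ^ 2 ∂(volume : Measure Sq)
      ≤ ∫ p, g p ^ 2 ∂(volume : Measure Sq) - 2 * t * (∫ p in A, g p) + t ^ 2 := by
  have hgi : Integrable g (volume : Measure Sq) := hg.integrable one_le_two
  have h1 : ∀ p, (g p - t * A.indicator 1 p) ^ 2
      = g p ^ 2 - 2 * t * A.indicator g p + t ^ 2 * A.indicator 1 p := fun p => by
    by_cases hp : p ∈ A
    · simp only [Set.indicator_of_mem hp, Pi.one_apply]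
      ring
    · simp only [Set.indicator_of_notMem hp]
      ring
  have hi1 : Integrable (fun p => 2 * t * A.indicator g p) (volume : Measure Sq) :=
    (hgi.indicator hA).const_mul _
  have hi2 : Integrable (fun p => t ^ 2 * A.indicator (1 : Sq → ℝ) p) (volume : Measure Sq) :=
    ((integrable_const (1 : ℝ)).indicator hA).const_mul _
  have hi3 : Integrable (fun p => g p ^ 2 - 2 * t * A.indicator g p) (volume : Measure Sq) :=
    hg.integrable_sq.sub hi1
  simp_rw [h1]
  rw [integral_add hi3 hi2, integral_sub hg.integrable_sq hi1,
    integral_const_mul, integral_const_mul, integral_indicator hA, integral_indicator_one hA]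
  have h2 : (volume : Measure Sq).real A ≤ 1 := measureReal_le_one
  nlinarith [sq_nonneg t]

theorem exists_stepEnergy_lt {N : ℕ} (hw : ∀ n, Measurable (w n))
    (hC : ∀ n, ∀ᵐ p ∂(volume : Measure Sq), |w n p| ≤ C) {c : unitInterval → Fin N}
    (hc : Measurable c) {B : ℝ} (hB : 0 ≤ B) (hclose : ¬ CutClose w c B) :
    ∃ c' : unitInterval → Fin (N * 4), Measurable c' ∧
      stepEnergy w c' < stepEnergy w c - B ^ 2 / 2 := by
  simp only [CutClose, not_forall, not_le] at hclose
  obtain ⟨S, T, hS, hT, hlt⟩ := hclose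
  obtain ⟨c', hc', href⟩ := exists_refinement hc hS hT
  refine ⟨c', hc', ?_⟩
  set g : ℕ → Sq → ℝ := fun n p => w n p - fiberAverage volume (pairLabel c) (w n) p with hg
  set a : ℕ → ℝ := fun n => ∫ p in S ×ˢ T, g n p with ha
  set D : ℝ := ∑' n, (1 / 2 : ℝ) ^ n * |a n| with hD
  have hDB : B < D := hlt
  have hsum : Summable fun n => (1 / 2 : ℝ) ^ n * |a n| := by
    by_contra h
    rw [hD, tsum_eq_zero_of_not_summable h] at hDB
    linarith
  have hstep : ∀ n, ∫ p, (w n p - fiberAverage volume (pairLabel c') (w n) p) ^ 2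
      ∂(volume : Measure Sq) ≤ ∫ p, g n p ^ 2 ∂(volume : Measure Sq) - D * |a n| + D ^ 2 / 4 := by
    intro n
    have hwn := memLp_two_of_ae_bound (hw n) (hC n)
    have hgn : MemLp (g n) 2 (volume : Measure Sq) :=
      hwn.sub (memLp_of_factorsThrough (measurable_pairLabel hc) (factorsThrough_fiberAverage _))
    set t : ℝ := D / 2 * SignType.sign (a n) with ht
    have hfac : Function.FactorsThrough (fun p => fiberAverage volume (pairLabel c) (w n) p
        + t * (S ×ˢ T).indicator 1 p) (pairLabel c') := by
      rintro ⟨x, y⟩ ⟨x', y'⟩ hp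
      obtain ⟨h1, h2⟩ := Prod.mk.inj hp
      obtain ⟨hx, hxS, -⟩ := href x x' h1
      obtain ⟨hy, -, hyT⟩ := href y y' h2
      have hpc : pairLabel c (x, y) = pairLabel c (x', y') := Prod.ext hx hy
      have hmem : (x, y) ∈ S ×ˢ T ↔ (x', y') ∈ S ×ˢ T := and_congr hxS hyT
      simp only [factorsThrough_fiberAverage (μ := volume) (w n) hpc]
      by_cases h : (x, y) ∈ S ×ˢ T
      · rw [Set.indicator_of_mem h, Set.indicator_of_mem (hmem.1 h)]
        rfl
      · rw [Set.indicator_of_notMem h, Set.indicator_of_notMem (fun h' => h (hmem.2 h'))]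
    have h1 := integral_sub_fiberAverage_sq_le (measurable_pairLabel hc') hwn hfac
    simp only [← sub_sub] at h1
    have h2 := integral_sub_smul_indicator_sq_le hgn (hS.prod hT) t
    have h3 : t * a n = D / 2 * |a n| := by
      rw [ht, mul_assoc, sign_mul_self]
    have h4 : t ^ 2 ≤ D ^ 2 / 4 := by
      rcases lt_trichotomy (a n) 0 with h | h | h
      · rw [ht, sign_neg h]
        norm_num
        linarith
      · rw [ht, h]
        norm_num
        positivity
      · rw [ht, sign_pos h]
        norm_num
        linarith
    have h5 : ∫ p, (w n p - fiberAverage volume (pairLabel c') (w n) p) ^ 2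
        ∂(volume : Measure Sq) ≤ ∫ p, g n p ^ 2 ∂(volume : Measure Sq)
          - 2 * t * (∫ p in S ×ˢ T, g n p) + t ^ 2 := h1.trans h2
    have h6 : 2 * t * (∫ p in S ×ˢ T, g n p) = D * |a n| := by
      change 2 * t * a n = _
      linarith
    linarith
  have hE : Summable fun n => (1 / 2 : ℝ) ^ n * ∫ p, g n p ^ 2 ∂(volume : Measure Sq) :=
    summable_stepEnergy hw hC hc
  have hgeo := summable_geometric_two
  have hle : stepEnergy w c' ≤ ∑' n, ((1 / 2 : ℝ) ^ n * ∫ p, g n p ^ 2 ∂(volume : Measure Sq)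
      - D * ((1 / 2 : ℝ) ^ n * |a n|) + (1 / 2 : ℝ) ^ n * (D ^ 2 / 4)) := by
    refine (summable_stepEnergy hw hC hc').tsum_le_tsum (fun n => ?_)
      ((hE.sub (hsum.mul_left D)).add (hgeo.mul_right _))
    have := mul_le_mul_of_nonneg_left (hstep n) (by positivity : (0 : ℝ) ≤ (1 / 2) ^ n)
    refine this.trans (le_of_eq ?_)
    ring
  rw [(hE.sub (hsum.mul_left D)).tsum_add (hgeo.mul_right _), hE.tsum_sub (hsum.mul_left D),
    tsum_mul_left, tsum_mul_right, tsum_geometric_two] at hle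
  have hce : ∑' n, (1 / 2 : ℝ) ^ n * ∫ p, g n p ^ 2 ∂(volume : Measure Sq) = stepEnergy w c := rfl
  rw [hce] at hle
  nlinarith

theorem exists_cutClose_or_stepEnergy_lt (hw : ∀ n, Measurable (w n))
    (hC : ∀ n, ∀ᵐ p ∂(volume : Measure Sq), |w n p| ≤ C) {B : ℝ} (hB : 0 ≤ B) (m : ℕ) :
    (∃ l ≤ m, ∃ c : unitInterval → Fin (4 ^ l), Measurable c ∧ CutClose w c B) ∨
    ∃ c : unitInterval → Fin (4 ^ (m + 1)), Measurable c ∧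
      stepEnergy w c < (∑' n, (1 / 2 : ℝ) ^ n * ∫ p, w n p ^ 2 ∂(volume : Measure Sq))
        - (m + 1) * (B ^ 2 / 2) := by
  induction m with
  | zero =>
    have hc : Measurable fun _ : unitInterval => (0 : Fin (4 ^ 0)) := measurable_const
    by_cases h : CutClose w (fun _ : unitInterval => (0 : Fin (4 ^ 0))) B
    · exact Or.inl ⟨0, le_rfl, _, hc, h⟩
    · obtain ⟨c', hc', hle⟩ := exists_stepEnergy_lt hw hC hc hB h
      refine Or.inr ⟨c', hc', ?_⟩
      have := stepEnergy_le hw hC hc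
      push_cast
      linarith
  | succ m ih =>
    rcases ih with ⟨l, hl, h⟩ | ⟨c, hc, hle⟩
    · exact Or.inl ⟨l, hl.trans m.le_succ, h⟩
    by_cases h : CutClose w c B
    · exact Or.inl ⟨m + 1, le_rfl, c, hc, h⟩
    · obtain ⟨c', hc', hle'⟩ := exists_stepEnergy_lt hw hC hc hB h
      refine Or.inr ⟨c', hc', hle'.trans_le ?_⟩
      push_cast
      linarith

end EnergyIncrement

theorem exists_cutClose {w : ℕ → Sq → ℝ} {C : ℝ} (hw : ∀ n, Measurable (w n))
    (hC : ∀ n, ∀ᵐ p ∂(volume : Measure Sq), |w n p| ≤ C) {k : ℕ} (hk : 2 ≤ k) :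
    ∃ c : unitInterval → Fin k, Measurable c ∧
      CutClose w c (Real.sqrt 8 / Real.sqrt (Real.log k) *
        Real.sqrt (∑' n, (1 / 2 : ℝ) ^ n * ∫ p, w n p ^ 2 ∂(volume : Measure Sq))) := by
  set E : ℝ := ∑' n, (1 / 2 : ℝ) ^ n * ∫ p, w n p ^ 2 ∂(volume : Measure Sq) with hE
  set B : ℝ := Real.sqrt 8 / Real.sqrt (Real.log k) * Real.sqrt E with hB
  have hE0 : 0 ≤ E :=
    tsum_nonneg fun n => mul_nonneg (by positivity) (integral_nonneg fun p => sq_nonneg _)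
  have hB0 : 0 ≤ B := by positivity
  have hkpos : (1 : ℝ) < k := by exact_mod_cast hk
  have hlog : 0 < Real.log k := Real.log_pos hkpos
  have hBsq : B ^ 2 * Real.log k = 8 * E := by
    rw [hB, mul_pow, div_pow, Real.sq_sqrt (by norm_num), Real.sq_sqrt hlog.le,
      Real.sq_sqrt hE0]
    field_simp
  have of_small : ∀ l ≤ Nat.log 4 k, (∃ c : unitInterval → Fin (4 ^ l), Measurable c ∧
      CutClose w c B) → ∃ c : unitInterval → Fin k, Measurable c ∧ CutClose w c B := by
    rintro l hl ⟨c, hc, hclose⟩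
    have hlk : 4 ^ l ≤ k := (Nat.pow_le_pow_right (by norm_num) hl).trans
      (Nat.pow_log_le_self 4 (by omega))
    refine ⟨Fin.castLE hlk ∘ c, (measurable_of_finite _).comp hc, fun S T hS hT => ?_⟩
    have hinj : Function.Injective (Prod.map (Fin.castLE hlk) (Fin.castLE hlk)) :=
      (Fin.castLE_injective hlk).prodMap (Fin.castLE_injective hlk)
    have hpair : pairLabel (Fin.castLE hlk ∘ c)
        = Prod.map (Fin.castLE hlk) (Fin.castLE hlk) ∘ pairLabel c := rfl
    simp only [hpair, fiberAverage_comp_injective _ _ hinj]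
    exact hclose S T hS hT
  rcases exists_cutClose_or_stepEnergy_lt hw hC hB0 (Nat.log 4 k) with ⟨l, hl, h⟩ | ⟨c, hc, hle⟩
  · exact of_small l hl h
  rw [← hE] at hle
  have h0 := stepEnergy_nonneg w c
  have hlt : Real.log k < (Nat.log 4 k + 1) * 4 := by
    have h1 : (k : ℝ) < 4 ^ (Nat.log 4 k + 1) := by
      exact_mod_cast Nat.lt_pow_succ_log_self (by norm_num) k
    have h2 := Real.log_lt_log (by linarith) h1
    rw [Real.log_pow] at h2
    have h3 : Real.log 4 ≤ 4 := Real.log_le_self (by norm_num)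
    push_cast at h2
    exact h2.trans_le (mul_le_mul_of_nonneg_left h3 (by positivity))
  have hEpos : 0 < E := by
    have : 0 ≤ ((Nat.log 4 k : ℝ) + 1) * (B ^ 2 / 2) := by positivity
    linarith
  have h1 := mul_lt_mul_of_pos_right hlt hEpos
  have h2 := mul_lt_mul_of_pos_right (h0.trans_lt hle) hlog
  have h3 : ((Nat.log 4 k : ℝ) + 1) * (B ^ 2 / 2) * Real.log k = (Nat.log 4 k + 1) * 4 * E := by
    linear_combination ((Nat.log 4 k : ℝ) + 1) / 2 * hBsq
  rw [zero_mul, sub_mul, h3] at h2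
  linarith

section SignedKernel

/-- The values of a signed measure-valued map are almost everywhere uniformly bounded. -/
def AEUniformlyBounded (W : Sq → SignedMeasure Z) : Prop :=
  ∃ C : ℝ, ∀ᵐ p ∂(volume : Measure Sq), ∀ A : Set Z, |W p A| ≤ C

omit [TopologicalSpace Z] in
theorem IsSignedKernel.aeUniformlyBounded {W : Sq → SignedMeasure Z} (hW : IsSignedKernel W) :
    AEUniformlyBounded W := by
  refine ⟨(TVbound W).toReal, ?_⟩
  filter_upwards [ae_le_essSup (f := fun p => TVnorm (W p)) (μ := (volume : Measure Sq))]
    with p hp A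
  exact (abs_apply_le_totalVariation _ A).trans (ENNReal.toReal_mono hW.2.ne hp)

variable [BorelSpace Z] {f : BoundedContinuousFunction Z ℝ}
  {W : Sq → SignedMeasure Z}

theorem abs_sint_le (h01 : ∀ x, f x ∈ Set.Icc (0 : ℝ) 1) {s : SignedMeasure Z} {C : ℝ}
    (hC : ∀ A, |s A| ≤ C) : |sint f s| ≤ C := by
  have hp := integral_mem_Icc_of_unitInterval_valued (μ := s.toJordanDecomposition.posPart)
    f.continuous.measurable h01
  have hn := integral_mem_Icc_of_unitInterval_valued (μ := s.toJordanDecomposition.negPart)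
    f.continuous.measurable h01
  have hp' := hp.2.trans (posPart_real_univ_le hC)
  have hn' := hn.2.trans (negPart_real_univ_le hC)
  rw [sint, abs_le]
  constructor <;> linarith [hp.1, hn.1]

variable [MeasurableSpace.CountablyGenerated Z]

theorem measurable_sint (h01 : ∀ x, f x ∈ Set.Icc (0 : ℝ) 1)
    (hW : ∀ A, MeasurableSet A → Measurable fun p => W p A) :
    Measurable fun p => sint f (W p) :=
  (measurable_integral_of_unitInterval_valued (measurable_posPart hW)
      f.continuous.measurable h01).sub
    (measurable_integral_of_unitInterval_valued (measurable_negPart hW)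
      f.continuous.measurable h01)

theorem sint_skernelInt (h01 : ∀ x, f x ∈ Set.Icc (0 : ℝ) 1)
    (hW : ∀ A, MeasurableSet A → Measurable fun p => W p A) (hb : AEUniformlyBounded W)
    (A : Set Sq) : sint f (skernelInt W A) = ∫ p in A, sint f (W p) := by
  obtain ⟨C, hC⟩ := hb
  have hC' := ae_restrict_of_ae (s := A) hC
  have hfm := f.continuous.measurable
  have hpos : ∀ᵐ p ∂(volume.restrict A : Measure Sq),
      (W p).toJordanDecomposition.posPart.real Set.univ ≤ C :=
    hC'.mono fun p hp => posPart_real_univ_le hp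
  have hneg : ∀ᵐ p ∂(volume.restrict A : Measure Sq),
      (W p).toJordanDecomposition.negPart.real Set.univ ≤ C :=
    hC'.mono fun p hp => negPart_real_univ_le hp
  have hmp := measurable_posPart hW
  have hmn := measurable_negPart hW
  have hfp := isFiniteMeasure_bind hmp hpos
  have hfn := isFiniteMeasure_bind hmn hneg
  have hint : ∀ (κ : Sq → Measure Z) [∀ p, IsFiniteMeasure (κ p)], Measurable κ →
      (∀ᵐ p ∂(volume.restrict A : Measure Sq), (κ p).real Set.univ ≤ C) →
      Integrable (fun p => ∫ x, f x ∂κ p) (volume.restrict A) := fun κ _ hκ hle =>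
    Integrable.of_bound
      (measurable_integral_of_unitInterval_valued hκ hfm h01).aestronglyMeasurable C
      (hle.mono fun p hp => by
        have := integral_mem_Icc_of_unitInterval_valued (μ := κ p) hfm h01
        rw [Real.norm_eq_abs, abs_of_nonneg this.1]
        exact this.2.trans hp)
  rw [sint_eq_of_eq_sub f (s := skernelInt W A)
      (by rw [skernelInt, toSigned, toSigned, dif_pos hfp, dif_pos hfn]),
    integral_bind_of_unitInterval_valued hmp hfm h01,
    integral_bind_of_unitInterval_valued hmn hfm h01,
    ← integral_sub (hint _ hmp hpos) (hint _ hmn hneg)]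
  rfl

end SignedKernel

section Stepping

variable {k : ℕ} {c : unitInterval → Fin k}

/-- The partition of `[0,1]` into the fibers of a measurable labelling. -/
def FinPartition.ofLabel (c : unitInterval → Fin k) (hc : Measurable c) : FinPartition where
  n := k
  part i := c ⁻¹' {i}
  measurableSet i := hc (measurableSet_singleton i)
  disjoint i j hij := Disjoint.preimage c (Set.disjoint_singleton.2 hij)
  covers := by
    ext x
    simp

omit [TopologicalSpace Z] in
theorem steppingS_ofLabel (W : Sq → SignedMeasure Z) (hc : Measurable c) (p : Sq) :
    steppingS W (FinPartition.ofLabel c hc) p =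
      ((volume (c ⁻¹' {c p.1})).toReal * (volume (c ⁻¹' {c p.2})).toReal)⁻¹ •
        skernelInt W ((c ⁻¹' {c p.1}) ×ˢ (c ⁻¹' {c p.2})) := by
  change ∑ i : Fin k, ∑ j : Fin k, Set.indicator ((c ⁻¹' {i}) ×ˢ (c ⁻¹' {j}))
      (fun _ => (((volume (c ⁻¹' {i})).toReal * (volume (c ⁻¹' {j})).toReal)⁻¹ : ℝ) •
        skernelInt W ((c ⁻¹' {i}) ×ˢ (c ⁻¹' {j}))) p = _
  rw [Finset.sum_eq_single (c p.1), Finset.sum_eq_single (c p.2)]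
  · rw [Set.indicator_of_mem]
    exact ⟨rfl, rfl⟩
  · exact fun j _ hj => Set.indicator_of_notMem (fun h => hj (Eq.symm h.2)) _
  · simp
  · exact fun i _ hi => Finset.sum_eq_zero fun j _ =>
      Set.indicator_of_notMem (fun h => hi (Eq.symm h.1)) _
  · simp

theorem exists_steppingS_ofLabel_eq (W : Sq → SignedMeasure Z) (hc : Measurable c) :
    ∃ G : Fin k × Fin k → SignedMeasure Z,
      ∀ p, steppingS W (FinPartition.ofLabel c hc) p = G (pairLabel c p) :=
  ⟨fun i => ((volume (c ⁻¹' {i.1})).toReal * (volume (c ⁻¹' {i.2})).toReal)⁻¹ •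
    skernelInt W ((c ⁻¹' {i.1}) ×ˢ (c ⁻¹' {i.2})), steppingS_ofLabel W hc⟩

theorem measurable_sub_steppingS {W : Sq → SignedMeasure Z}
    (hW : ∀ A, MeasurableSet A → Measurable fun p => W p A) (hc : Measurable c)
    (A : Set Z) (hA : MeasurableSet A) :
    Measurable fun p => (W p - steppingS W (FinPartition.ofLabel c hc) p) A := by
  obtain ⟨G, hG⟩ := exists_steppingS_ofLabel_eq W hc
  simp only [sub_apply, hG]
  exact (hW A hA).sub ((measurable_of_finite fun i => G i A).comp (measurable_pairLabel hc))

theorem aeUniformlyBounded_sub_steppingS {W : Sq → SignedMeasure Z}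
    (hb : AEUniformlyBounded W) (hc : Measurable c) :
    AEUniformlyBounded fun p => W p - steppingS W (FinPartition.ofLabel c hc) p := by
  obtain ⟨G, hG⟩ := exists_steppingS_ofLabel_eq W hc
  obtain ⟨C, hC⟩ := hb
  obtain ⟨K, hK⟩ := (Set.finite_range fun i => (G i).totalVariation.real Set.univ).bddAbove
  refine ⟨C + K, hC.mono fun p hp A => ?_⟩
  simp only [sub_apply, hG]
  refine (abs_sub _ _).trans (add_le_add (hp A) ?_)
  exact (abs_apply_le_totalVariation _ A).trans (hK ⟨pairLabel c p, rfl⟩)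

variable [BorelSpace Z] [MeasurableSpace.CountablyGenerated Z]
  {f : BoundedContinuousFunction Z ℝ} {W : Sq → SignedMeasure Z}

theorem sint_steppingS_ofLabel (h01 : ∀ x, f x ∈ Set.Icc (0 : ℝ) 1)
    (hW : ∀ A, MeasurableSet A → Measurable fun p => W p A) (hb : AEUniformlyBounded W)
    (hc : Measurable c) (p : Sq) :
    sint f (steppingS W (FinPartition.ofLabel c hc) p) =
      fiberAverage volume (pairLabel c) (fun q => sint f (W q)) p := by
  have hpre : pairLabel c ⁻¹' {pairLabel c p} = (c ⁻¹' {c p.1}) ×ˢ (c ⁻¹' {c p.2}) := by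
    ext q
    simp [pairLabel]
  rw [steppingS_ofLabel, sint_smul, sint_skernelInt h01 hW hb, fiberAverage, setAverage_eq, hpre,
    smul_eq_mul, Measure.volume_eq_prod, measureReal_prod_prod]
  rfl

theorem cutNormFS_sub_steppingS_le {F : ℕ → BoundedContinuousFunction Z ℝ}
    (h01 : ∀ n x, F n x ∈ Set.Icc (0 : ℝ) 1)
    (hW : ∀ A, MeasurableSet A → Measurable fun p => W p A) (hb : AEUniformlyBounded W)
    (hc : Measurable c) {B : ℝ} (hB : CutClose (fun n p => sint (F n) (W p)) c B) :
    cutNormFS F (fun p => W p - steppingS W (FinPartition.ofLabel c hc) p) ≤ B := by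
  have : Nonempty {p : Set unitInterval × Set unitInterval //
      MeasurableSet p.1 ∧ MeasurableSet p.2} := ⟨⟨(∅, ∅), .empty, .empty⟩⟩
  refine ciSup_le fun ⟨⟨S, T⟩, hS, hT⟩ => ?_
  simp only [FnormS, sint_skernelInt (h01 _) (measurable_sub_steppingS hW hc)
    (aeUniformlyBounded_sub_steppingS hb hc), sint_sub, sint_steppingS_ofLabel (h01 _) hW hb hc]
  exact hB S T hS hT

end Stepping

theorem norm2F_le_sqrt_two [BorelSpace Z] [MeasurableSpace.CountablyGenerated Z]
    {F : ℕ → BoundedContinuousFunction Z ℝ} (h01 : ∀ n x, F n x ∈ Set.Icc (0 : ℝ) 1)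
    {W : Sq → SignedMeasure Z} (hW : ∀ A, MeasurableSet A → Measurable fun p => W p A)
    (h1 : ∀ p A, |W p A| ≤ 1) : norm2F F W ≤ Real.sqrt 2 := by
  have hm := fun n => measurable_sint (h01 n) hW
  have hle : ∀ n, ∀ᵐ p ∂(volume : Measure Sq), |sint (F n) (W p)| ≤ 1 := fun n =>
    ae_of_all _ fun p => abs_sint_le (h01 n) (h1 p)
  refine Real.sqrt_le_sqrt ?_
  refine le_of_le_of_eq ?_ tsum_geometric_two
  refine (summable_integral_sq hm hle).tsum_le_tsum (fun n => ?_) summable_geometric_two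
  have := integral_sq_le_of_ae_bound (hm n) (hle n)
  exact mul_le_of_le_one_right (by positivity) (by simpa using this)

/-- **Weak regularity lemma for the cut norm `‖·‖_{□,F}`.**
Let `F` be a convergence determining sequence.  For every signed measure-valued kernel
`W` and every integer `k ≥ 2`, there exists a finite measurable partition `𝒫` of
`[0,1]` with exactly `k` classes such that
`‖W − W_𝒫‖_{□,F} ≤ (√8/√(log k)) ‖W‖_{2,F}`.
In particular, if `W` is a probability-graphon (so that `‖W‖_{2,F} ≤ √2`), there is
such a partition with `‖W − W_𝒫‖_{□,F} ≤ 4/√(log k)`. -/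
theorem weak_regularity_lemma_for_cut_norm
    {Z : Type*} [MeasurableSpace Z] [TopologicalSpace Z] [PolishSpace Z] [BorelSpace Z]
    (F : ℕ → BoundedContinuousFunction Z ℝ) (hF : IsConvDet F)
    (W : Sq → SignedMeasure Z) (hW : IsSignedKernel W) (k : ℕ) (hk : 2 ≤ k) :
    (∃ P : FinPartition, P.n = k ∧
      cutNormFS F (fun p => W p - steppingS W P p) ≤
        Real.sqrt 8 / Real.sqrt (Real.log k) * norm2F F W) ∧
    ((∀ p : Sq, (W p).toJordanDecomposition.negPart = 0 ∧
        (W p).toJordanDecomposition.posPart Set.univ = 1) →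
      ∃ P : FinPartition, P.n = k ∧
        cutNormFS F (fun p => W p - steppingS W P p) ≤ 4 / Real.sqrt (Real.log k)) := by
  have h01 := hF.2.1
  have hm := fun n => measurable_sint (h01 n) hW.1
  have hb := hW.aeUniformlyBounded
  obtain ⟨c, hc, hclose⟩ : ∃ c : unitInterval → Fin k, Measurable c ∧
      CutClose (fun n p => sint (F n) (W p)) c
        (Real.sqrt 8 / Real.sqrt (Real.log k) * norm2F F W) := by
    obtain ⟨C, hC⟩ := hb
    exact exists_cutClose hm (fun n => hC.mono fun p hp => abs_sint_le (h01 n) hp) hk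
  have hmain := cutNormFS_sub_steppingS_le h01 hW.1 hb hc hclose
  refine ⟨⟨FinPartition.ofLabel c hc, rfl, hmain⟩, fun hprob =>
    ⟨FinPartition.ofLabel c hc, rfl, hmain.trans ?_⟩⟩
  have hnorm : norm2F F W ≤ Real.sqrt 2 := by
    refine norm2F_le_sqrt_two h01 hW.1 fun p A => ?_
    refine (abs_apply_le_totalVariation (W p) A).trans (le_of_eq ?_)
    rw [SignedMeasure.totalVariation, (hprob p).1, add_zero, measureReal_def, (hprob p).2,
      ENNReal.toReal_one]
  have h4 : Real.sqrt 8 * Real.sqrt 2 = 4 := by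
    rw [← Real.sqrt_mul (by norm_num), show (8 : ℝ) * 2 = 4 ^ 2 by norm_num,
      Real.sqrt_sq (by norm_num)]
  calc Real.sqrt 8 / Real.sqrt (Real.log k) * norm2F F W
      ≤ Real.sqrt 8 / Real.sqrt (Real.log k) * Real.sqrt 2 :=
        mul_le_mul_of_nonneg_left hnorm (by positivity)
    _ = 4 / Real.sqrt (Real.log k) := by rw [div_mul_eq_mul_div, h4]


end PG
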